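/- Fix integers n ≥ 2 and 1 ≤ k ≤ n, and assume p_{k-1} and p_n have no common zero (i.e. p_{k-1}(x_{j,n}) ≠ 0 for all 1 ≤ j ≤ n). Define the n×n matrix C by: C_{i,j} = a_k² λ_{j,n} λ_{i,k-1} p_{k-1}(x_{j,n})² p_k(x_{i,k-1})²/(x_{i,k-1} − x_{j,n})² for 1 ≤ i ≤ k−1; C_{i,j} = a_k² λ_{j,n} λ^{(k)}_{i,n-k} p_{k-1}(x_{j,n})²/(y_{i,n-k} − x_{j,n})² for k ≤ i ≤ n−1; and C_{n,j} = λ_{j,n} p_{k-1}(x_{j,n})². Then C is doubly stochastic, x_{i,k-1} = Σ_{j=1}^{n} C_{i,j} x_{j,n} for 1 ≤ i ≤ k−1, y_{i,n-k} = Σ_{j=1}^{n} C_{i,j} x_{j,n} for k ≤ i ≤ n−1, and b_{k-1} = Σ_{j=1}^{n} C_{n,j} x_{j,n}. -/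

import Mathlib

open MeasureTheory Polynomial Finset

lemma aux_cd (A B F G : ℕ → ℝ) (y t : ℝ)
    (hF : ∀ m, y * F (m+1) = A (m+1) * F (m+2) + B m * F (m+1) + A m * F m)
    (hG : ∀ m, t * G (m+1) = A (m+1) * G (m+2) + B m * G (m+1) + A m * G m) (N : ℕ) :
    (y - t) * ∑ m ∈ range N, F (m+1) * G (m+1) =
      A N * (F (N+1) * G N - F N * G (N+1)) - A 0 * (F 1 * G 0 - F 0 * G 1) := by
  induction N with
  | zero => simp
  | succ N ih =>
    rw [Finset.sum_range_succ, mul_add, ih]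
    linear_combination G (N+1) * hF N - F (N+1) * hG N

lemma aux_conf (A B F D : ℕ → ℝ) (y : ℝ)
    (hF : ∀ m, y * F (m+1) = A (m+1) * F (m+2) + B m * F (m+1) + A m * F m)
    (hD : ∀ m, F (m+1) + y * D (m+1) = A (m+1) * D (m+2) + B m * D (m+1) + A m * D m)
    (hF0 : F 0 = 0) (hD0 : D 0 = 0) (N : ℕ) :
    ∑ m ∈ range N, F (m+1) ^ 2 = A N * (D (N+1) * F N - D N * F (N+1)) := by
  induction N with
  | zero => simp [hF0, hD0]
  | succ N ih =>
    rw [Finset.sum_range_succ, ih]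
    linear_combination F (N+1) * hD N - D (N+1) * hF N

lemma aux_mono (f : ℕ → ℝ) (l h : ℕ) (hf : ∀ j, l ≤ j → j + 1 ≤ h → f j < f (j+1))
    (i j : ℕ) (hi : l ≤ i) (hij : i < j) (hj : j ≤ h) : f i < f j := by
  induction j, hij using Nat.le_induction with
  | base => exact hf i hi hj
  | succ m hm ih => exact (ih (by omega)).trans (hf m (by omega) hj)

lemma aux_ne (f : ℕ → ℝ) (l h : ℕ) (hf : ∀ j, l ≤ j → j + 1 ≤ h → f j < f (j+1))
    (i j : ℕ) (hi : l ≤ i) (hi' : i ≤ h) (hj' : l ≤ j) (hj : j ≤ h) (hne : i ≠ j) : f i ≠ f j := by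
  rcases lt_or_gt_of_ne hne with h1 | h1
  · exact (aux_mono f l h hf i j hi h1 hj).ne
  · exact (aux_mono f l h hf j i hj' h1 hi').ne'

lemma aux_Icc (f : ℕ → ℝ) (n : ℕ) : ∑ i ∈ Icc 1 n, f i = ∑ i : Fin n, f (i+1) := by
  rw [Fin.sum_univ_eq_sum_range (fun i => f (i+1))]
  induction n with
  | zero => simp
  | succ n ih => rw [Finset.sum_Icc_succ_top (by omega), ih, Finset.sum_range_succ]

lemma aux_low (f g : ℕ → ℝ) (κ n : ℕ) (h : κ ≤ n) :
    ∑ m ∈ range n, (if m < κ then f m else 0) * g m = ∑ m ∈ range κ, f m * g m := by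
  obtain ⟨r, rfl⟩ := Nat.exists_eq_add_of_le h
  rw [Finset.sum_range_add]
  have h1 : ∑ m ∈ range κ, (if m < κ then f m else 0) * g m = ∑ m ∈ range κ, f m * g m := by
    refine Finset.sum_congr rfl fun m hm => ?_
    rw [if_pos (Finset.mem_range.1 hm)]
  have h2 : ∑ m ∈ range r, (if κ + m < κ then f (κ + m) else 0) * g (κ + m) = 0 := by
    refine Finset.sum_eq_zero fun m hm => ?_
    rw [if_neg (by omega), zero_mul]
  rw [h1, h2, add_zero]

lemma aux_high (f g : ℕ → ℝ) (k r : ℕ) :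
    ∑ m ∈ range (k + r), (if k ≤ m then f (m - k) else 0) * g m
      = ∑ m ∈ range r, f m * g (k + m) := by
  rw [Finset.sum_range_add]
  have h1 : ∑ m ∈ range k, (if k ≤ m then f (m - k) else 0) * g m = 0 := by
    refine Finset.sum_eq_zero fun m hm => ?_
    have := Finset.mem_range.1 hm
    rw [if_neg (by omega), zero_mul]
  have h2 : ∑ m ∈ range r, (if k ≤ k + m then f (k + m - k) else 0) * g (k + m)
      = ∑ m ∈ range r, f m * g (k + m) := by
    refine Finset.sum_congr rfl fun m hm => ?_
    rw [if_pos (by omega), Nat.add_sub_cancel_left]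
  rw [h1, h2, zero_add]

/-- Linear algebra core. -/
lemma aux_core (n : ℕ) (w v : ℕ → ℕ → ℝ)
    (hv : ∀ i j, i < n → j < n → ∑ m ∈ range n, v i m * v j m = if i = j then 1 else 0)
    (hw : ∀ i j, i < n → j < n → ∑ m ∈ range n, w i m * w j m = if i = j then 1 else 0) :
    (∀ i < n, ∑ j : Fin n, (∑ m ∈ range n, w i m * v j m) ^ 2 = 1) ∧
    (∀ j < n, ∑ i : Fin n, (∑ m ∈ range n, w i m * v j m) ^ 2 = 1) ∧
    (∀ i < n, ∀ κ < n, ∑ j : Fin n, (∑ m ∈ range n, w i m * v j m) * v j κ = w i κ) ∧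
    (∀ i < n, ∀ κ < n, ∑ j : Fin n, v j i * v j κ = if i = κ then 1 else 0) := by
  let V : Matrix (Fin n) (Fin n) ℝ := Matrix.of fun i j => v i j
  let W : Matrix (Fin n) (Fin n) ℝ := Matrix.of fun i j => w i j
  have hV : V * V.transpose = 1 := by
    ext i j
    simp only [Matrix.mul_apply, V, Matrix.transpose_apply, Matrix.of_apply, Matrix.one_apply]
    rw [Fin.sum_univ_eq_sum_range (fun m => v i m * v j m), hv i j i.2 j.2]
    simp [Fin.ext_iff]
  have hW : W * W.transpose = 1 := by
    ext i j
    simp only [Matrix.mul_apply, W, Matrix.transpose_apply, Matrix.of_apply, Matrix.one_apply]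
    rw [Fin.sum_univ_eq_sum_range (fun m => w i m * w j m), hw i j i.2 j.2]
    simp [Fin.ext_iff]
  have hV' : V.transpose * V = 1 := mul_eq_one_comm.1 hV
  have hW' : W.transpose * W = 1 := mul_eq_one_comm.1 hW
  have hM : ∀ i j : Fin n, (W * V.transpose) i j = ∑ m ∈ range n, w i m * v j m := by
    intro i j
    simp only [Matrix.mul_apply, V, W, Matrix.transpose_apply, Matrix.of_apply]
    rw [Fin.sum_univ_eq_sum_range (fun m => w i m * v j m)]
  have h1 : (W * V.transpose) * (W * V.transpose).transpose = 1 := by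
    rw [Matrix.transpose_mul, Matrix.transpose_transpose, Matrix.mul_assoc,
      ← Matrix.mul_assoc V.transpose, hV', Matrix.one_mul, hW]
  have h2 : (W * V.transpose).transpose * (W * V.transpose) = 1 := mul_eq_one_comm.1 h1
  have h3 : (W * V.transpose) * V = W := by rw [Matrix.mul_assoc, hV', Matrix.mul_one]
  refine ⟨?_, ?_, ?_, ?_⟩
  · intro i hi
    have := congrFun (congrFun h1 ⟨i, hi⟩) ⟨i, hi⟩
    rw [Matrix.mul_apply, Matrix.one_apply_eq] at this
    rw [← this]
    refine Finset.sum_congr rfl fun j _ => ?_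
    rw [Matrix.transpose_apply, hM, sq]
  · intro i hi
    have := congrFun (congrFun h2 ⟨i, hi⟩) ⟨i, hi⟩
    rw [Matrix.mul_apply, Matrix.one_apply_eq] at this
    rw [← this]
    refine Finset.sum_congr rfl fun j _ => ?_
    rw [Matrix.transpose_apply, hM, sq]
  · intro i hi κ hκ
    have := congrFun (congrFun h3 ⟨i, hi⟩) ⟨κ, hκ⟩
    rw [Matrix.mul_apply] at this
    simp only [hM] at this
    exact this
  · intro i hi κ hκ
    have := congrFun (congrFun hV' ⟨i, hi⟩) ⟨κ, hκ⟩
    rw [Matrix.mul_apply, Matrix.one_apply] at this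
    simp only [Fin.mk.injEq] at this
    exact this

/-- Orthonormality of normalised eigenvectors. -/
lemma aux_orth (A B : ℕ → ℝ) (q : ℕ → ℝ → ℝ) (hq0 : ∀ t, q 0 t = 0) (hq1 : ∀ t, q 1 t ≠ 0)
    (hq : ∀ m t, t * q (m+1) t = A (m+1) * q (m+2) t + B m * q (m+1) t + A m * q m t)
    (N : ℕ) (hN : 0 < N) (l : ℝ → ℝ) (hl : ∀ t, l t = (∑ m ∈ range N, q (m+1) t ^ 2)⁻¹) (t s : ℝ)
    (ht : q (N+1) t = 0) (hs : q (N+1) s = 0) :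
    0 < l t ∧ ∑ m ∈ range N, (√(l t) * q (m+1) t) * (√(l s) * q (m+1) s)
      = if t = s then 1 else 0 := by
  have hpos : 0 < ∑ m ∈ range N, q (m+1) t ^ 2 :=
    Finset.sum_pos' (fun _ _ => sq_nonneg _)
      ⟨0, Finset.mem_range.2 hN, by have := hq1 t; positivity⟩
  have hlpos : 0 < l t := by rw [hl]; exact inv_pos.2 hpos
  refine ⟨hlpos, ?_⟩
  split_ifs with h
  · subst h
    have : ∀ m ∈ range N, (√(l t) * q (m+1) t) * (√(l t) * q (m+1) t) = l t * q (m+1) t ^ 2 := by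
      intro m _
      have := Real.mul_self_sqrt hlpos.le
      linear_combination q (m+1) t ^ 2 * this
    rw [Finset.sum_congr rfl this, ← Finset.mul_sum, hl, inv_mul_cancel₀ hpos.ne']
  · have := aux_cd A B (fun m => q m t) (fun m => q m s) t s (fun m => hq m t) (fun m => hq m s) N
    simp only [ht, hs, hq0] at this
    have h0 : ∑ m ∈ range N, q (m+1) t * q (m+1) s = 0 := by
      have h2 : (t - s) ≠ 0 := sub_ne_zero.2 h
      apply (mul_right_inj' h2).1
      rw [this]; ring
    have : ∀ m ∈ range N, (√(l t) * q (m+1) t) * (√(l s) * q (m+1) s)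
      = (√(l t) * √(l s)) * (q (m+1) t * q (m+1) s) := by intro m _; ring
    rw [Finset.sum_congr rfl this, ← Finset.mul_sum, h0, mul_zero]

theorem stmt_16
    (μ : Measure ℝ) [IsProbabilityMeasure μ]
    (lo hi : ℝ)
    (hsupp : μ (Set.Icc lo hi)ᶜ = 0)
    (hinf : ∀ s : Finset ℝ, μ (↑s : Set ℝ)ᶜ ≠ 0)
    (p : ℕ → Polynomial ℝ)
    (hdeg : ∀ m : ℕ, (p m).degree = m)
    (hlead : ∀ m : ℕ, 0 < (p m).leadingCoeff)
    (horth : ∀ m l : ℕ, ∫ t, (p m).eval t * (p l).eval t ∂μ = if m = l then 1 else 0)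
    (a b : ℕ → ℝ)
    (hapos : ∀ m : ℕ, 1 ≤ m → 0 < a m)
    (hrec0 : Polynomial.X * p 0 = Polynomial.C (a 1) * p 1 + Polynomial.C (b 0) * p 0)
    (hrec : ∀ m : ℕ, Polynomial.X * p (m + 1) =
      Polynomial.C (a (m + 2)) * p (m + 2) + Polynomial.C (b (m + 1)) * p (m + 1) +
        Polynomial.C (a (m + 1)) * p m)
    (x : ℕ → ℕ → ℝ)
    (hxroot : ∀ m j : ℕ, 1 ≤ j → j ≤ m → (p m).eval (x m j) = 0)
    (hxmono : ∀ m j : ℕ, 1 ≤ j → j + 1 ≤ m → x m j < x m (j + 1))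
    (lam : ℕ → ℕ → ℝ)
    (hlam : ∀ m j : ℕ, lam m j = (∑ i ∈ Finset.range m, ((p i).eval (x m j)) ^ 2)⁻¹)
    (P : ℕ → ℕ → Polynomial ℝ)
    (hP0 : ∀ k : ℕ, P k 0 = 1)
    (hPrec0 : ∀ k : ℕ, Polynomial.X * P k 0 =
      Polynomial.C (a (k + 1)) * P k 1 + Polynomial.C (b k) * P k 0)
    (hPrec : ∀ k m : ℕ, Polynomial.X * P k (m + 1) =
      Polynomial.C (a (m + k + 2)) * P k (m + 2) + Polynomial.C (b (m + k + 1)) * P k (m + 1) +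
        Polynomial.C (a (m + k + 1)) * P k m)
    (n k : ℕ) (hn : 2 ≤ n) (hk1 : 1 ≤ k) (hk2 : k ≤ n)
    (Y : ℕ → ℝ)
    (hYroot : ∀ i : ℕ, k ≤ i → i ≤ n - 1 → (P k (n - k)).eval (Y i) = 0)
    (hYmono : ∀ i : ℕ, k ≤ i → i + 1 ≤ n - 1 → Y i < Y (i + 1))
    (lamk : ℕ → ℝ)
    (hlamk : ∀ i : ℕ, k ≤ i → i ≤ n - 1 → lamk i =
      (a n * ((Polynomial.derivative (P k (n - k))).eval (Y i)) *
        ((P k (n - k - 1)).eval (Y i)))⁻¹)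
    (hnocommon : ∀ j : ℕ, 1 ≤ j → j ≤ n → (p (k - 1)).eval (x n j) ≠ 0)
    (C : ℕ → ℕ → ℝ)
    (hC1 : ∀ i j : ℕ, 1 ≤ i → i ≤ k - 1 → 1 ≤ j → j ≤ n →
      C i j = a k ^ 2 * lam n j * lam (k - 1) i * ((p (k - 1)).eval (x n j)) ^ 2 *
        ((p k).eval (x (k - 1) i)) ^ 2 / (x (k - 1) i - x n j) ^ 2)
    (hC2 : ∀ i j : ℕ, k ≤ i → i ≤ n - 1 → 1 ≤ j → j ≤ n →
      C i j = a k ^ 2 * lam n j * lamk i * ((p (k - 1)).eval (x n j)) ^ 2 / (Y i - x n j) ^ 2)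
    (hC3 : ∀ j : ℕ, 1 ≤ j → j ≤ n → C n j = lam n j * ((p (k - 1)).eval (x n j)) ^ 2) :
    (∀ i j : ℕ, 1 ≤ i → i ≤ n → 1 ≤ j → j ≤ n → 0 ≤ C i j) ∧
    (∀ i : ℕ, 1 ≤ i → i ≤ n → ∑ j ∈ Finset.Icc 1 n, C i j = 1) ∧
    (∀ j : ℕ, 1 ≤ j → j ≤ n → ∑ i ∈ Finset.Icc 1 n, C i j = 1) ∧
    (∀ i : ℕ, 1 ≤ i → i ≤ k - 1 → x (k - 1) i = ∑ j ∈ Finset.Icc 1 n, C i j * x n j) ∧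
    (∀ i : ℕ, k ≤ i → i ≤ n - 1 → Y i = ∑ j ∈ Finset.Icc 1 n, C i j * x n j) ∧
    b (k - 1) = ∑ j ∈ Finset.Icc 1 n, C n j * x n j := by
  obtain ⟨κ, rfl⟩ : ∃ κ, k = κ + 1 := ⟨k - 1, by omega⟩
  obtain ⟨r, rfl⟩ := Nat.exists_eq_add_of_le hk2
  have e1 : κ + 1 - 1 = κ := by omega
  have e2 : κ + 1 + r - (κ + 1) = r := by omega
  simp only [e1, e2] at *
  set n := κ + 1 + r with hndef
  -- shifted sequences
  let q : ℕ → ℝ → ℝ := fun m t => Nat.casesOn m 0 (fun m => (p m).eval t)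
  have hqs : ∀ m t, q (m+1) t = (p m).eval t := fun _ _ => rfl
  have hq0 : ∀ t, q 0 t = 0 := fun _ => rfl
  have hq1 : ∀ t, q 1 t ≠ 0 := by
    intro t
    show (p 0).eval t ≠ 0
    rw [Polynomial.eq_C_of_degree_le_zero (p := p 0) (le_of_eq (by simpa using hdeg 0)),
      Polynomial.eval_C]
    exact Polynomial.coeff_ne_zero_of_eq_degree (hdeg 0)
  have hq : ∀ m t, t * q (m+1) t = a (m+1) * q (m+2) t + b m * q (m+1) t + a m * q m t := by
    intro m t
    cases m with
    | zero =>
      have := congrArg (Polynomial.eval t) hrec0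
      simp only [eval_mul, eval_add, eval_C, eval_X] at this
      rw [hq0, mul_zero, add_zero]
      exact this
    | succ m => simpa [q] using congrArg (Polynomial.eval t) (hrec m)
  let Q : ℕ → ℝ → ℝ := fun m t => Nat.casesOn m 0 (fun m => (P (κ+1) m).eval t)
  let D : ℕ → ℝ → ℝ := fun m t => Nat.casesOn m 0 (fun m => (derivative (P (κ+1) m)).eval t)
  have hQs : ∀ m t, Q (m+1) t = (P (κ+1) m).eval t := fun _ _ => rfl
  have hQ0 : ∀ t, Q 0 t = 0 := fun _ => rfl
  have hQ1' : ∀ t, Q 1 t = 1 := by intro t; show (P (κ+1) 0).eval t = 1; rw [hP0]; simp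
  have hQ1 : ∀ t, Q 1 t ≠ 0 := by intro t; rw [hQ1']; exact one_ne_zero
  have hQ : ∀ m t, t * Q (m+1) t = a (κ+1+(m+1)) * Q (m+2) t + b (κ+1+m) * Q (m+1) t
      + a (κ+1+m) * Q m t := by
    intro m t
    cases m with
    | zero =>
      have := congrArg (Polynomial.eval t) (hPrec0 (κ+1))
      simp only [eval_mul, eval_add, eval_C, eval_X] at this
      rw [hQ0, mul_zero, add_zero]
      exact this
    | succ m =>
      have := congrArg (Polynomial.eval t) (hPrec (κ+1) m)
      simp only [eval_mul, eval_add, eval_C, eval_X] at this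
      rw [show κ+1+(m+1+1) = m + (κ+1) + 2 by omega, show κ+1+(m+1) = m + (κ+1) + 1 by omega]
      exact this
  have hD : ∀ m t, Q (m+1) t + t * D (m+1) t = a (κ+1+(m+1)) * D (m+2) t
      + b (κ+1+m) * D (m+1) t + a (κ+1+m) * D m t := by
    intro m t
    cases m with
    | zero =>
      have := congrArg (fun f => Polynomial.eval t (derivative f)) (hPrec0 (κ+1))
      simp only [derivative_mul, derivative_add, derivative_C, derivative_X, eval_mul, eval_add,
        eval_C, eval_X, one_mul, zero_mul, zero_add] at this
      rw [show D 0 t = 0 from rfl, mul_zero, add_zero]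
      exact this
    | succ m =>
      have := congrArg (fun f => Polynomial.eval t (derivative f)) (hPrec (κ+1) m)
      simp only [derivative_mul, derivative_add, derivative_C, derivative_X, eval_mul, eval_add,
        eval_C, eval_X, eval_one, one_mul, zero_mul, zero_add, eval_zero] at this
      rw [show κ+1+(m+1+1) = m + (κ+1) + 2 by omega, show κ+1+(m+1) = m + (κ+1) + 1 by omega]
      exact this
  -- Christoffel functions
  let L : ℕ → ℝ → ℝ := fun N t => (∑ m ∈ range N, q (m+1) t ^ 2)⁻¹
  have hlamL : ∀ m j, lam m j = L m (x m j) := fun m j => hlam m j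
  let K : ℝ → ℝ := fun t => (∑ m ∈ range r, Q (m+1) t ^ 2)⁻¹
  have hlamK : ∀ i, κ + 1 ≤ i → i ≤ n - 1 → lamk i = K (Y i) := by
    intro i h1 h2
    obtain ⟨s, hs⟩ : ∃ s, r = s + 1 := ⟨r - 1, by omega⟩
    rw [hlamk i h1 h2]
    have := aux_conf (fun m => a (κ+1+m)) (fun m => b (κ+1+m)) (fun m => Q m (Y i))
      (fun m => D m (Y i)) (Y i) (fun m => hQ m _) (fun m => hD m _) rfl rfl r
    have hr : Q (r+1) (Y i) = 0 := hYroot i h1 h2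
    simp only [hr] at this
    show _ = (∑ m ∈ range r, Q (m+1) (Y i) ^ 2)⁻¹
    rw [this]
    have e3 : Q r (Y i) = eval (Y i) (P (κ+1) (r-1)) := by rw [hs]; rfl
    have e4 : D (r+1) (Y i) = eval (Y i) (derivative (P (κ+1) r)) := rfl
    rw [e3, e4]
    congr 1
    ring
  have hxne : ∀ m i j, 1 ≤ i → i ≤ m → 1 ≤ j → j ≤ m → i ≠ j → x m i ≠ x m j :=
    fun m i j h1 h2 h3 h4 h5 => aux_ne (x m) 1 m (hxmono m) i j h1 h2 h3 h4 h5
  have hYne : ∀ i j, κ+1 ≤ i → i ≤ n-1 → κ+1 ≤ j → j ≤ n-1 → i ≠ j → Y i ≠ Y j :=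
    fun i j h1 h2 h3 h4 h5 => aux_ne Y (κ+1) (n-1) hYmono i j h1 h2 h3 h4 h5
  -- orthonormal systems
  have hOx : ∀ m i j, 1 ≤ i → i ≤ m → 1 ≤ j → j ≤ m → 0 < L m (x m i) ∧
      ∑ l ∈ range m, (√(L m (x m i)) * q (l+1) (x m i)) * (√(L m (x m j)) * q (l+1) (x m j))
        = if i = j then 1 else 0 := by
    intro m i j h1 h2 h3 h4
    have := aux_orth a b q hq0 hq1 hq m (by omega) (L m) (fun _ => rfl) (x m i) (x m j)
      (hxroot m i h1 h2) (hxroot m j h3 h4)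
    refine ⟨this.1, this.2.trans ?_⟩
    by_cases h : i = j
    · simp [h]
    · rw [if_neg h, if_neg (hxne m i j h1 h2 h3 h4 h)]
  have hOY : ∀ i j, κ+1 ≤ i → i ≤ n-1 → κ+1 ≤ j → j ≤ n-1 → 0 < K (Y i) ∧
      ∑ l ∈ range r, (√(K (Y i)) * Q (l+1) (Y i)) * (√(K (Y j)) * Q (l+1) (Y j))
        = if i = j then 1 else 0 := by
    intro i j h1 h2 h3 h4
    have := aux_orth (fun m => a (κ+1+m)) (fun m => b (κ+1+m)) Q hQ0 hQ1 hQ r (by omega) K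
      (fun _ => rfl) (Y i) (Y j) (hYroot i h1 h2) (hYroot j h3 h4)
    refine ⟨this.1, this.2.trans ?_⟩
    by_cases h : i = j
    · simp [h]
    · rw [if_neg h, if_neg (hYne i j h1 h2 h3 h4 h)]
  let v : ℕ → ℕ → ℝ := fun j m => √(L n (x n (j+1))) * q (m+1) (x n (j+1))
  let wa : ℕ → ℕ → ℝ := fun i m => √(L κ (x κ (i+1))) * q (m+1) (x κ (i+1))
  let wb : ℕ → ℕ → ℝ := fun i m => √(K (Y (i+1))) * Q (m+1) (Y (i+1))
  let w : ℕ → ℕ → ℝ := fun i m =>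
    if i < κ then (if m < κ then wa i m else 0)
    else if i + 1 < n then (if κ+1 ≤ m then wb i (m-(κ+1)) else 0)
    else if m = κ then 1 else 0
  have w1 : ∀ i, i < κ → ∀ g : ℕ → ℝ, ∑ m ∈ range n, w i m * g m = ∑ m ∈ range κ, wa i m * g m := by
    intro i hi g
    simp only [w, if_pos hi]
    exact aux_low (wa i) g κ n (by omega)
  have w2 : ∀ i, κ ≤ i → i + 1 < n → ∀ g : ℕ → ℝ, ∑ m ∈ range n, w i m * g m
      = ∑ m ∈ range r, wb i m * g (κ+1+m) := by
    intro i hi hi2 g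
    simp only [w, if_neg (not_lt.2 hi), if_pos hi2]
    exact aux_high (wb i) g (κ+1) r
  have w3 : ∀ i, κ ≤ i → i + 1 = n → ∀ g : ℕ → ℝ, ∑ m ∈ range n, w i m * g m = g κ := by
    intro i hi hi2 g
    simp only [w, if_neg (not_lt.2 hi), if_neg (show ¬ (i + 1 < n) by omega), ite_mul, one_mul,
      zero_mul]
    rw [Finset.sum_ite_eq' (range n) κ g, if_pos (Finset.mem_range.2 (by omega))]
  have hv : ∀ i j, i < n → j < n → ∑ m ∈ range n, v i m * v j m = if i = j then 1 else 0 := by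
    intro i j hi hj
    refine (hOx n (i+1) (j+1) (by omega) (by omega) (by omega) (by omega)).2.trans ?_
    simp
  have hw : ∀ i j, i < n → j < n → ∑ m ∈ range n, w i m * w j m = if i = j then 1 else 0 := by
    intro i j hi hj
    rcases lt_or_ge i κ with h1 | h1
    · rw [w1 i h1]
      rcases lt_or_ge j κ with h2 | h2
      · have : ∀ m ∈ range κ, wa i m * w j m = wa i m * wa j m := by
          intro m hm
          simp only [w, if_pos h2, if_pos (Finset.mem_range.1 hm)]
        rw [Finset.sum_congr rfl this]
        refine (hOx κ (i+1) (j+1) (by omega) (by omega) (by omega) (by omega)).2.trans ?_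
        simp
      · rw [if_neg (by omega)]
        refine Finset.sum_eq_zero fun m hm => ?_
        have := Finset.mem_range.1 hm
        simp only [w, if_neg (not_lt.2 h2), if_neg (show ¬ (κ + 1 ≤ m) by omega),
          if_neg (show ¬ (m = κ) by omega), ite_self, mul_zero]
    · rcases Nat.lt_or_ge (i+1) n with h3 | h3
      · rw [w2 i h1 h3]
        by_cases h2 : κ ≤ j ∧ j + 1 < n
        · have : ∀ m ∈ range r, wb i m * w j (κ+1+m) = wb i m * wb j m := by
            intro m hm
            simp only [w, if_neg (not_lt.2 h2.1), if_pos h2.2, if_pos (show κ+1 ≤ κ+1+m by omega),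
              Nat.add_sub_cancel_left]
          rw [Finset.sum_congr rfl this]
          refine (hOY (i+1) (j+1) (by omega) (by omega) (by omega) (by omega)).2.trans ?_
          simp
        · rw [if_neg (by omega)]
          refine Finset.sum_eq_zero fun m hm => ?_
          have : w j (κ+1+m) = 0 := by
            simp only [w, if_neg (show ¬ (κ+1+m < κ) by omega),
              if_neg (show ¬ (κ+1+m = κ) by omega)]
            split_ifs <;> first | rfl | omega
          rw [this, mul_zero]
      · rw [w3 i h1 (by omega)]
        by_cases h : i = j
        · subst h
          simp only [w, if_neg (not_lt.2 h1), if_neg (not_lt.2 h3), if_true]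
        · rw [if_neg h]
          simp only [w]
          split_ifs <;> first | rfl | omega
  obtain ⟨hrow, hcol, hwt, hvv⟩ := aux_core n w v hv hw
  set M : ℕ → ℕ → ℝ := fun i j => ∑ m ∈ range n, w i m * v j m with hM
  have hLn : ∀ j, j < n → 0 < L n (x n (j+1)) := fun j hj =>
    (hOx n (j+1) (j+1) (by omega) (by omega) (by omega) (by omega)).1
  have hsq : ∀ t : ℝ, 0 < t → √t ^ 2 = t := fun t ht => Real.sq_sqrt ht.le
  -- eigen-relations
  have hM1 : ∀ i j, i < κ → j < n → (x n (j+1) - x κ (i+1)) * M i j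
      = (- (√(L κ (x κ (i+1))) * a (κ+1) * q (κ+2) (x κ (i+1)))) * v j κ := by
    intro i j hi hj
    have e : M i j = √(L κ (x κ (i+1))) * √(L n (x n (j+1))) *
        ∑ m ∈ range κ, q (m+1) (x κ (i+1)) * q (m+1) (x n (j+1)) := by
      simp only [hM, w1 i hi, wa, v]
      rw [Finset.mul_sum]
      exact Finset.sum_congr rfl fun m _ => by ring
    have hcd := aux_cd a b (fun m => q m (x κ (i+1))) (fun m => q m (x n (j+1))) (x κ (i+1))
      (x n (j+1)) (fun m => hq m _) (fun m => hq m _) κ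
    have hz : q (κ+1) (x κ (i+1)) = 0 := hxroot κ (i+1) (by omega) (by omega)
    have hr := hq κ (x κ (i+1))
    simp only [hz, hq0] at hcd hr
    rw [e]
    simp only [v]
    linear_combination (-(√(L κ (x κ (i+1))) * √(L n (x n (j+1))))) * hcd
      + √(L κ (x κ (i+1))) * √(L n (x n (j+1))) * q (κ+1) (x n (j+1)) * (-hr)
  have hM2 : ∀ i j, κ ≤ i → i + 1 < n → j < n → (x n (j+1) - Y (i+1)) * M i j
      = (√(K (Y (i+1))) * a (κ+1)) * v j κ := by
    intro i j hi hi2 hj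
    have e : M i j = √(K (Y (i+1))) * √(L n (x n (j+1))) *
        ∑ m ∈ range r, Q (m+1) (Y (i+1)) * q (κ+1+(m+1)) (x n (j+1)) := by
      simp only [hM, w2 i hi hi2, wb, v]
      rw [Finset.mul_sum]
      exact Finset.sum_congr rfl fun m _ => by
        rw [show κ+1+(m+1) = κ+1+m+1 by omega]; ring
    have hcd := aux_cd (fun m => a (κ+1+m)) (fun m => b (κ+1+m)) (fun m => Q m (Y (i+1)))
      (fun m => q (κ+1+m) (x n (j+1))) (Y (i+1))
      (x n (j+1)) (fun m => hQ m _) (fun m => hq (κ+1+m) _) r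
    have hz : Q (r+1) (Y (i+1)) = 0 := hYroot (i+1) (by omega) (by omega)
    have hz2 : q (κ+1+(r+1)) (x n (j+1)) = 0 := hxroot n (j+1) (by omega) (by omega)
    simp only [hz, hz2, hQ0, hQ1', add_zero] at hcd
    rw [e]
    simp only [v]
    linear_combination (-(√(K (Y (i+1))) * √(L n (x n (j+1))))) * hcd
  -- identification of C
  have hCM : ∀ i j, i < n → j < n → C (i+1) (j+1) = M i j ^ 2 := by
    intro i j hi hj
    have hnc := hnocommon (j+1) (by omega) (by omega)
    have hvsq : v j κ ^ 2 = L n (x n (j+1)) * (eval (x n (j+1)) (p κ)) ^ 2 := by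
      simp only [v, hqs, mul_pow, hsq _ (hLn j hj)]
    rcases lt_or_ge i κ with h1 | h1
    · rw [hC1 (i+1) (j+1) (by omega) (by omega) (by omega) (by omega), hlamL, hlamL]
      have hne : x κ (i+1) - x n (j+1) ≠ 0 := by
        intro h
        apply hnc
        rw [← sub_eq_zero.1 h]
        exact hxroot κ (i+1) (by omega) (by omega)
      have hlp := (hOx κ (i+1) (i+1) (by omega) (by omega) (by omega) (by omega)).1
      rw [div_eq_iff (pow_ne_zero 2 hne)]
      have := congrArg (fun z => z ^ 2) (hM1 i j h1 hj)
      simp only [mul_pow, neg_sq, hsq _ hlp, hvsq] at this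
      rw [hqs] at this
      linear_combination -this
    · rcases Nat.lt_or_ge (i+1) n with h3 | h3
      · rw [hC2 (i+1) (j+1) (by omega) (by omega) (by omega) (by omega), hlamL,
          hlamK (i+1) (by omega) (by omega)]
        have hlp := (hOY (i+1) (i+1) (by omega) (by omega) (by omega) (by omega)).1
        have hh := hM2 i j h1 h3 hj
        have hne : Y (i+1) - x n (j+1) ≠ 0 := by
          intro h
          rw [← neg_sub, h, neg_zero, zero_mul] at hh
          have e5 := (Real.sqrt_pos.2 hlp).ne'
          have e6 := (hapos (κ+1) (by omega)).ne'
          have e7 := (Real.sqrt_pos.2 (hLn j hj)).ne'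
          exact mul_ne_zero (mul_ne_zero e5 e6) (mul_ne_zero e7 hnc) hh.symm
        rw [div_eq_iff (pow_ne_zero 2 hne)]
        have := congrArg (fun z => z ^ 2) hh
        simp only [mul_pow, hsq _ hlp, hvsq] at this
        linear_combination -this
      · rw [show i + 1 = n by omega, hC3 (j+1) (by omega) (by omega), hlamL]
        simp only [hM, w3 i h1 (show i + 1 = n by omega)]
        rw [hvsq]
  have hwsum : ∀ i, i < n → ∀ y c, w i κ = 0 →
      (∀ j, j < n → (x n (j+1) - y) * M i j = c * v j κ) →
      y = ∑ j ∈ Icc 1 n, C (i+1) j * x n j := by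
    intro i hi y c h0 hc
    rw [aux_Icc (fun j => C (i+1) j * x n j)]
    have e : ∀ j : Fin n, C (i+1) (j+1) * x n (j+1) = y * M i j ^ 2 + c * (M i j * v j κ) := by
      intro j
      rw [hCM i j hi j.2]
      linear_combination M i j * hc j j.2
    rw [Finset.sum_congr rfl fun j _ => e j, Finset.sum_add_distrib, ← Finset.mul_sum,
      ← Finset.mul_sum, hrow i hi, hwt i hi κ (by omega), h0]
    ring
  refine ⟨?_, ?_, ?_, ?_, ?_, ?_⟩
  · intro i j h1 h2 h3 h4
    obtain ⟨i, rfl⟩ : ∃ i', i = i' + 1 := ⟨i - 1, by omega⟩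
    obtain ⟨j, rfl⟩ : ∃ j', j = j' + 1 := ⟨j - 1, by omega⟩
    rw [hCM i j (by omega) (by omega)]
    exact sq_nonneg _
  · intro i h1 h2
    obtain ⟨i, rfl⟩ : ∃ i', i = i' + 1 := ⟨i - 1, by omega⟩
    rw [aux_Icc (fun j => C (i+1) j), ← hrow i (by omega)]
    exact Finset.sum_congr rfl fun j _ => hCM i j (by omega) j.2
  · intro j h1 h2
    obtain ⟨j, rfl⟩ : ∃ j', j = j' + 1 := ⟨j - 1, by omega⟩
    rw [aux_Icc (fun i => C i (j+1)), ← hcol j (by omega)]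
    exact Finset.sum_congr rfl fun i _ => hCM i j i.2 (by omega)
  · intro i h1 h2
    obtain ⟨i, rfl⟩ : ∃ i', i = i' + 1 := ⟨i - 1, by omega⟩
    refine hwsum i (by omega) _ _ ?_ (fun j hj => hM1 i j (by omega) hj)
    simp [w, show i < κ by omega]
  · intro i h1 h2
    obtain ⟨i, rfl⟩ : ∃ i', i = i' + 1 := ⟨i - 1, by omega⟩
    refine hwsum i (by omega) _ _ ?_ (fun j hj => hM2 i j (by omega) (by omega) hj)
    simp [w, show ¬ i < κ by omega, show i + 1 < n by omega]
  · rw [aux_Icc (fun j => C n j * x n j)]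
    have e : ∀ j : Fin n, C n (j+1) * x n (j+1) = a (κ+1) * (v j (κ+1) * v j κ)
        + b κ * (v j κ * v j κ)
        + a κ * (√(L n (x n (j+1))) * q κ (x n (j+1)) * v j κ) := by
      intro j
      rw [hC3 (j+1) (by omega) (by omega), hlamL]
      have := hq κ (x n (j+1))
      have h2 := hsq _ (hLn j j.2)
      rw [← hqs]
      simp only [v]
      linear_combination √(L n (x n (j+1))) ^ 2 * q (κ+1) (x n (j+1)) * this
        - q (κ+1) (x n (j+1)) ^ 2 * x n (j+1) * h2
    rw [Finset.sum_congr rfl fun j _ => e j, Finset.sum_add_distrib, Finset.sum_add_distrib,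
      ← Finset.mul_sum, ← Finset.mul_sum, ← Finset.mul_sum, hvv κ (by omega) κ (by omega)]
    have s1 : ∑ j : Fin n, v j (κ+1) * v j κ = 0 := by
      rcases Nat.eq_zero_or_pos r with hr | hr
      · refine Finset.sum_eq_zero fun j _ => ?_
        have h0 : eval (x n (j+1)) (p n) = 0 := hxroot n (j+1) (by omega) (by omega)
        have h1 : n = κ + 1 := by omega
        have h2 : q (κ+1+1) (x n (j+1)) = 0 := by
          rw [hqs, ← h0]; congr 2; exact h1.symm
        simp only [v, h2]; ring
      · rw [hvv (κ+1) (by omega) κ (by omega), if_neg (by omega)]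
    have s2 : ∑ j : Fin n, √(L n (x n (j+1))) * q κ (x n (j+1)) * v j κ = 0 := by
      rcases Nat.eq_zero_or_pos κ with hr | hr
      · refine Finset.sum_eq_zero fun j _ => ?_
        have h2 : q κ (x n (j+1)) = 0 := by rw [hr]; exact hq0 (x n (j+1))
        rw [h2]; ring
      · obtain ⟨s, hs⟩ : ∃ s, κ = s + 1 := ⟨κ - 1, by omega⟩
        have := hvv s (by omega) κ (by omega)
        rw [if_neg (by omega)] at this
        rw [← this]
        refine Finset.sum_congr rfl fun j _ => ?_
        have h2 : q κ (x n (j+1)) = q (s+1) (x n (j+1)) := by rw [hs]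
        rw [h2]
    rw [s1, s2, if_pos rfl]
    ring
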